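/- Let k be an even integer with k ≥ 4 and let s ∈ ℂ with Re(s) > −k/2. Then the iterated integral ∫_0^∞ ( ∫_{-∞}^{∞} e^{−2πi b} (b + i(a+1))^{−k} db ) a^{k/2 + s − 1} da converges and equals (2πi)^k · e^{−2π} · (2π)^{−(k/2+s)} · Γ(k/2 + s) / Γ(k). -/

import Mathlib

open MeasureTheory Set Filter Topology FourierTransform

lemma integrableOn_pow_mul_cexp_neg_mul_Ioi (n : ℕ) {c : ℂ} (hc : 0 < c.re) :
    IntegrableOn (fun t : ℝ => (t : ℂ) ^ n * Complex.exp (-(c * t))) (Ioi 0) := by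
  have h := integrableOn_rpow_mul_exp_neg_mul_rpow (s := n) (p := 1) (b := c.re)
    (by have : (0 : ℝ) ≤ n := n.cast_nonneg
        linarith) one_pos hc
  refine Integrable.mono' h (by fun_prop) ?_
  filter_upwards [ae_restrict_mem measurableSet_Ioi] with t ht
  rw [norm_mul, norm_pow, Complex.norm_real, Complex.norm_exp, Real.norm_of_nonneg (le_of_lt ht)]
  simp

lemma integral_pow_mul_cexp_neg_mul_Ioi (n : ℕ) {c : ℂ} (hc : 0 < c.re) :
    ∫ t : ℝ in Ioi 0, (t : ℂ) ^ n * Complex.exp (-(c * t)) = n.factorial / c ^ (n + 1) := by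
  have hc0 : c ≠ 0 := by
    rintro rfl
    simp at hc
  induction n with
  | zero =>
    have h := integral_exp_mul_complex_Ioi (a := -c) (by simpa using hc) 0
    simpa using h
  | succ n ih =>
    have hderiv : ∀ t : ℝ, HasDerivAt
        (fun t : ℝ => (t : ℂ) ^ (n + 1) * Complex.exp (-(c * t)))
        ((n + 1 : ℂ) * ((t : ℂ) ^ n * Complex.exp (-(c * t)))
          - c * ((t : ℂ) ^ (n + 1) * Complex.exp (-(c * t)))) t := by
      intro t
      have h1 : HasDerivAt (fun t : ℝ => (t : ℂ)) 1 t := Complex.ofRealCLM.hasDerivAt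
      have h2 := (h1.pow (n + 1)).mul ((h1.const_mul c).neg.cexp)
      refine h2.congr_deriv ?_
      simp
      ring
    have hi0 := (integrableOn_pow_mul_cexp_neg_mul_Ioi n hc).const_mul (n + 1 : ℂ)
    have hi1 := (integrableOn_pow_mul_cexp_neg_mul_Ioi (n + 1) hc).const_mul c
    have hlim : Tendsto (fun t : ℝ => (t : ℂ) ^ (n + 1) * Complex.exp (-(c * t))) atTop (𝓝 0) := by
      rw [tendsto_zero_iff_norm_tendsto_zero]
      refine (tendsto_rpow_mul_exp_neg_mul_atTop_nhds_zero (n + 1 : ℕ) c.re hc).congr' ?_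
      filter_upwards [eventually_ge_atTop 0] with t ht
      rw [norm_mul, norm_pow, Complex.norm_real, Complex.norm_exp, Real.norm_of_nonneg ht,
        Real.rpow_natCast]
      simp
    have h := integral_Ioi_of_hasDerivAt_of_tendsto' (a := 0) (fun t _ => hderiv t)
      (hi0.sub hi1) hlim
    rw [integral_sub hi0 hi1, integral_const_mul, integral_const_mul, ih] at h
    simp only [Complex.ofReal_zero, ne_eq, Nat.add_eq_zero_iff, one_ne_zero, and_false,
      not_false_eq_true, zero_pow, zero_mul, sub_zero] at h
    have h' := (sub_eq_zero.mp h).symm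
    rw [eq_div_iff (pow_ne_zero _ hc0)]
    rw [Nat.factorial_succ]
    push_cast
    calc _ = (c * ∫ t : ℝ in Ioi 0, (t : ℂ) ^ (n + 1) * Complex.exp (-(c * t))) * c ^ (n + 1) := by
          ring
      _ = _ := by
          rw [h']
          field_simp

lemma integrable_zpow_neg_add_I_mul {k : ℕ} (hk : 2 ≤ k) {y : ℝ} (hy : 1 ≤ y) :
    Integrable (fun b : ℝ => ((b : ℂ) + Complex.I * y) ^ (-(k : ℤ))) := by
  have hne (b : ℝ) : (b : ℂ) + Complex.I * y ≠ 0 := by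
    intro h
    have := congrArg Complex.im h
    simp at this
    linarith
  refine Integrable.mono' integrable_inv_one_add_sq ?_ (ae_of_all _ fun b => ?_)
  · refine Continuous.aestronglyMeasurable ?_
    exact Continuous.zpow₀ (by fun_prop) _ fun b => Or.inl (hne b)
  · rw [norm_zpow, zpow_neg, zpow_natCast]
    have hsq : ‖(b : ℂ) + Complex.I * y‖ ^ 2 = b ^ 2 + y ^ 2 := by
      rw [Complex.sq_norm, Complex.normSq_apply]
      simp
      ring
    have h1 : 1 ≤ ‖(b : ℂ) + Complex.I * y‖ := by
      rw [← one_le_sq_iff₀ (norm_nonneg _), hsq]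
      nlinarith [sq_nonneg b]
    apply inv_anti₀ (by positivity)
    calc 1 + b ^ 2 ≤ ‖(b : ℂ) + Complex.I * y‖ ^ 2 := by rw [hsq]; nlinarith
      _ ≤ _ := pow_le_pow_right₀ h1 hk

lemma integrable_cexp_mul_zpow_neg_add_I_mul {k : ℕ} (hk : 2 ≤ k) {y : ℝ} (hy : 1 ≤ y) :
    Integrable (fun b : ℝ => Complex.exp (-(2 * Real.pi * Complex.I * b)) *
      ((b : ℂ) + Complex.I * y) ^ (-(k : ℤ))) := by
  refine (integrable_zpow_neg_add_I_mul hk hy).bdd_mul (c := 1) (by fun_prop)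
    (ae_of_all _ fun b => ?_)
  rw [Complex.norm_exp]
  simp

lemma integral_cexp_mul_zpow_neg_add_I_mul {k : ℕ} (hk : 2 ≤ k) {y : ℝ} (hy : 1 ≤ y) :
    ∫ b : ℝ, Complex.exp (-(2 * Real.pi * Complex.I * b)) *
      ((b : ℂ) + Complex.I * y) ^ (-(k : ℤ)) =
    (-(2 * Real.pi * Complex.I)) ^ k / (k - 1).factorial * Complex.exp (-(2 * Real.pi * y)) := by
  obtain ⟨n, rfl⟩ : ∃ n, k = n + 1 := ⟨k - 1, by omega⟩
  rw [Nat.add_sub_cancel]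
  have hfact : (n.factorial : ℂ) ≠ 0 := Nat.cast_ne_zero.mpr n.factorial_ne_zero
  have hpi : (2 * Real.pi * Complex.I : ℂ) ≠ 0 := Complex.two_pi_I_ne_zero
  set f : ℝ → ℂ := (Ioi 0).indicator
    fun t : ℝ => (t : ℂ) ^ n * Complex.exp (-((2 * Real.pi * y : ℂ) * t)) with hf
  have hfi : Integrable f := by
    rw [hf, integrable_indicator_iff measurableSet_Ioi]
    refine integrableOn_pow_mul_cexp_neg_mul_Ioi n ?_
    simp
    positivity
  have hinv : 𝓕⁻ f = fun b : ℝ => (n.factorial / (-(2 * Real.pi * Complex.I)) ^ (n + 1) : ℂ) *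
      ((b : ℂ) + Complex.I * y) ^ (-((n + 1 : ℕ) : ℤ)) := by
    ext b
    have hre : 0 < (-(2 * Real.pi * Complex.I) * ((b : ℂ) + Complex.I * y)).re := by
      simp
      positivity
    have h := integral_pow_mul_cexp_neg_mul_Ioi n hre
    rw [Real.fourierInv_eq', zpow_neg, zpow_natCast, div_mul_eq_mul_div, ← div_eq_mul_inv,
      div_div, mul_comm (_ ^ (n + 1)), ← mul_pow, ← h,
      ← integral_indicator measurableSet_Ioi]
    congr 1 with t
    by_cases ht : t ∈ Ioi (0 : ℝ)
    · simp only [hf, indicator_of_mem ht, smul_eq_mul]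
      rw [mul_left_comm, ← Complex.exp_add]
      congr 2
      simp
      ring_nf
      simp
      ring
    · simp [hf, indicator_of_notMem ht]
  have hinvi : Integrable (𝓕⁻ f) := by
    rw [hinv]
    exact (integrable_zpow_neg_add_I_mul hk hy).const_mul _
  have hFi : Integrable (𝓕 f) := by
    have : 𝓕 f = fun b => (𝓕⁻ f) (-b) := by
      ext b
      rw [Real.fourierInv_eq_fourier_neg, neg_neg]
    rw [this]
    exact hinvi.comp_neg
  have hcont : ContinuousAt f 1 := by
    refine ContinuousAt.congr (f := fun t : ℝ => (t : ℂ) ^ n *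
      Complex.exp (-((2 * Real.pi * y : ℂ) * t))) (by fun_prop) ?_
    filter_upwards [Ioi_mem_nhds (zero_lt_one' ℝ)] with t ht
    rw [hf, indicator_of_mem ht]
  have h := hfi.fourier_fourierInv_eq hFi hcont
  rw [hinv, Real.fourier_real_eq_integral_exp_smul, hf, indicator_of_mem (mem_Ioi.mpr one_pos)] at h
  have h2 : (n.factorial / (-(2 * Real.pi * Complex.I)) ^ (n + 1) : ℂ) *
      ∫ b : ℝ, Complex.exp (-(2 * Real.pi * Complex.I * b)) *
        ((b : ℂ) + Complex.I * y) ^ (-((n + 1 : ℕ) : ℤ)) = Complex.exp (-(2 * Real.pi * y)) := by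
    rw [← integral_const_mul]
    refine Eq.trans ?_ (h.trans (by simp))
    congr 1 with b
    rw [smul_eq_mul, mul_left_comm]
    congr 3
    push_cast
    ring
  rw [← h2]
  field_simp

lemma integrableOn_cpow_mul_cexp_neg_mul_Ioi {a : ℂ} {r : ℝ} (ha : 0 < a.re) (hr : 0 < r) :
    IntegrableOn (fun t : ℝ => (t : ℂ) ^ (a - 1) * Complex.exp (-(r * t))) (Ioi 0) := by
  have h := integrableOn_rpow_mul_exp_neg_mul_rpow (s := a.re - 1) (p := 1) (b := r)
    (by linarith) one_pos hr
  refine Integrable.mono' h ?_ ?_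
  · refine ContinuousOn.aestronglyMeasurable (fun t ht => ?_) measurableSet_Ioi
    refine ContinuousAt.continuousWithinAt (ContinuousAt.mul ?_ (by fun_prop))
    exact Complex.continuousAt_ofReal_cpow_const _ _ (Or.inr (ne_of_gt ht))
  · filter_upwards [ae_restrict_mem measurableSet_Ioi] with t ht
    rw [norm_mul, Complex.norm_cpow_eq_rpow_re_of_pos ht, Complex.norm_exp]
    simp



/-- the evaluation (9.6) of the archimedean small-cell orbital integral
`I_{small,v}^{I₂}(s)` in Section 9 of the paper (matrix-coefficient normalization divided
out).  For `k` even, `k ≥ 4` and `Re s > −k/2`, the iterated integral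
`∫₀^∞ (∫ℝ e^{−2πib}(b+i(a+1))^{−k} db) a^{k/2+s−1} da` converges and equals
`(2πi)^k e^{−2π} (2π)^{−(k/2+s)} Γ(k/2+s)/Γ(k)`. -/
theorem stmt_14 (k : ℕ) (hk : Even k) (hk4 : 4 ≤ k) (s : ℂ) (hs : -(k : ℝ) / 2 < s.re) :
    (∀ a ∈ Ioi (0 : ℝ), Integrable (fun b : ℝ =>
        Complex.exp (-(2 * Real.pi * Complex.I * b)) *
          ((b : ℂ) + Complex.I * ((a : ℂ) + 1)) ^ (-(k : ℤ)))) ∧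
    IntegrableOn (fun a : ℝ =>
        (∫ b : ℝ, Complex.exp (-(2 * Real.pi * Complex.I * b)) *
            ((b : ℂ) + Complex.I * ((a : ℂ) + 1)) ^ (-(k : ℤ))) *
          (a : ℂ) ^ ((k : ℂ) / 2 + s - 1)) (Ioi 0) ∧
    (∫ a in Ioi (0 : ℝ),
        (∫ b : ℝ, Complex.exp (-(2 * Real.pi * Complex.I * b)) *
            ((b : ℂ) + Complex.I * ((a : ℂ) + 1)) ^ (-(k : ℤ))) *
          (a : ℂ) ^ ((k : ℂ) / 2 + s - 1)) =
      (2 * Real.pi * Complex.I) ^ k * Complex.exp (-(2 * Real.pi)) *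
        ((2 * Real.pi : ℝ) : ℂ) ^ (-((k : ℂ) / 2 + s)) *
        Complex.Gamma ((k : ℂ) / 2 + s) / Complex.Gamma (k : ℂ) := by
  have hw : 0 < ((k : ℂ) / 2 + s).re := by
    have : ((k : ℂ) / 2).re = (k : ℝ) / 2 := by simp
    rw [Complex.add_re, this]
    linarith
  have hcongr : EqOn (fun a : ℝ =>
        (∫ b : ℝ, Complex.exp (-(2 * Real.pi * Complex.I * b)) *
            ((b : ℂ) + Complex.I * ((a : ℂ) + 1)) ^ (-(k : ℤ))) *
          (a : ℂ) ^ ((k : ℂ) / 2 + s - 1))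
      (fun a : ℝ => ((2 * Real.pi * Complex.I) ^ k / (k - 1).factorial *
        Complex.exp (-(2 * Real.pi))) * ((a : ℂ) ^ ((k : ℂ) / 2 + s - 1) *
          Complex.exp (-((2 * Real.pi : ℝ) * a)))) (Ioi 0) := by
    intro a ha
    have h := integral_cexp_mul_zpow_neg_add_I_mul (k := k) (by omega) (y := a + 1)
      (by linarith [mem_Ioi.mp ha])
    push_cast at h
    have hexp : Complex.exp (-(2 * Real.pi * ((a : ℂ) + 1))) =
        Complex.exp (-(2 * Real.pi)) * Complex.exp (-(2 * Real.pi * a)) := by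
      rw [← Complex.exp_add]
      ring_nf
    simp only [h, hk.neg_pow, hexp]
    push_cast
    ring
  have hint := (integrableOn_cpow_mul_cexp_neg_mul_Ioi hw Real.two_pi_pos).const_mul
    ((2 * Real.pi * Complex.I) ^ k / (k - 1).factorial * Complex.exp (-(2 * Real.pi)))
  refine ⟨fun a ha => ?_, ?_, ?_⟩
  · have h := integrable_cexp_mul_zpow_neg_add_I_mul (k := k) (by omega) (y := a + 1)
      (by linarith [mem_Ioi.mp ha])
    push_cast at h
    exact h
  · exact IntegrableOn.congr_fun hint hcongr.symm measurableSet_Ioi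
  · rw [setIntegral_congr_fun measurableSet_Ioi hcongr, integral_const_mul,
      Complex.integral_cpow_mul_exp_neg_mul_Ioi hw Real.two_pi_pos]
    have hG : Complex.Gamma (k : ℂ) = (k - 1).factorial := by
      rw [← Complex.Gamma_nat_eq_factorial, Nat.cast_sub (by omega)]
      simp
    have hpow : (1 / ((2 * Real.pi : ℝ) : ℂ)) ^ ((k : ℂ) / 2 + s) =
        ((2 * Real.pi : ℝ) : ℂ) ^ (-((k : ℂ) / 2 + s)) := by
      rw [one_div, Complex.cpow_neg, Complex.inv_cpow]
      rw [Complex.arg_ofReal_of_nonneg Real.two_pi_pos.le]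
      exact Real.pi_ne_zero.symm
    rw [hG, hpow]
    ring
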